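/- arXiv:1810.06654 — 2 statements merged into one kernel-verified Lean document; each statement's English description precedes it below -/
import Mathlib

section
/- Let c₁, c₂ > 0, b > 0, g > 0, M > 0 be real constants, and let η : ℝ → ℝ be a continuous, monotone increasing, bounded function with η(s) = s for all s with |s| ≤ M/b. Suppose y : ℝ → ℝ is differentiable and satisfies y'(t) = -(c₁·g/b)·y(t) + (c₁·η(y(t)/b) + c₂)·(M - y(t)) for all t ≥ 0, with y(0) ∈ [0, M]. Then y(t) ∈ [0, M] for all t ≥ 0. -/
/-- Forward invariance of `[0, M]` for the cytosolic cholesterol mass ODE with the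
modified exchange term `q̃(u,v) = c₁u - c₁η(u)v - c₂v` (Remark 2.5 of the paper). -/
theorem stmt_0
    (c₁ c₂ b g M : ℝ) (hc₁ : 0 < c₁) (hc₂ : 0 < c₂) (hb : 0 < b) (hg : 0 < g)
    (hM : 0 < M)
    (η : ℝ → ℝ) (hηcont : Continuous η) (hηmono : Monotone η)
    (hηbdd : ∃ K : ℝ, ∀ s : ℝ, |η s| ≤ K)
    (hηid : ∀ s : ℝ, |s| ≤ M / b → η s = s)
    (y : ℝ → ℝ) (hy : Differentiable ℝ y)
    (hode : ∀ t : ℝ, 0 ≤ t →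
      deriv y t = -(c₁ * g / b) * y t + (c₁ * η (y t / b) + c₂) * (M - y t))
    (hy0 : y 0 ∈ Set.Icc (0 : ℝ) M) :
    ∀ t : ℝ, 0 ≤ t → y t ∈ Set.Icc (0 : ℝ) M := by
  intro t ht
  have hd : ∀ x, HasDerivAt y (deriv y x) x := fun x => (hy x).hasDerivAt
  have hη0 : η 0 = 0 := hηid 0 (by rw [abs_zero]; positivity)
  constructor
  · have h := image_le_of_deriv_right_lt_deriv_boundary (f := fun x => - y x)
      (f' := fun x => - deriv y x) (a := 0) (b := t) (B := fun _ => (0:ℝ)) (B' := fun _ => 0)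
      hy.continuous.neg.continuousOn
      (fun x _ => (hd x).neg.hasDerivWithinAt) (by simpa using hy0.1)
      (fun x => hasDerivAt_const x _)
      (by
        intro x hx h0
        have h1 : y x = 0 := by simpa using h0
        have h2 := hode x hx.1
        rw [h1, zero_div, hη0] at h2
        have : 0 < c₂ * M := by positivity
        show - deriv y x < 0
        rw [h2]; linarith)
      (Set.right_mem_Icc.2 ht)
    simpa using h
  · exact image_le_of_deriv_right_lt_deriv_boundary (f := y)
      (f' := deriv y) (a := 0) (b := t) (B := fun _ => M) (B' := fun _ => 0)
      hy.continuous.continuousOn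
      (fun x _ => (hd x).hasDerivWithinAt) hy0.2
      (fun x => hasDerivAt_const x _)
      (by
        intro x hx h1
        have h2 := hode x hx.1
        rw [h1] at h2
        have : 0 < c₁ * g / b * M := by positivity
        show deriv y x < 0
        rw [h2]; linarith)
      (Set.right_mem_Icc.2 ht)
end

section
/- Let c₁, c₂ > 0, b > 0, g > 0, M > 0 be real constants and define the quadratic polynomial p(y) = -(c₁/b)·y² + (c₁·(M - g)/b - c₂)·y + c₂·M. Suppose y : ℝ → ℝ is differentiable and satisfies y'(t) = p(y(t)) for all t ≥ 0, with y(0) ∈ [0, M]. Then y(t) ∈ [0, M] for all t ≥ 0. -/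
/-- Forward invariance of `[0, M]` for the ODE `y' = p(y)` governing the total cytosolic
cholesterol mass in the reduced lipid-raft model with exchange term
`q(u,v) = c₁u(1-v) - c₂v`. -/
theorem stmt_1
    (c₁ c₂ b g M : ℝ) (hc₁ : 0 < c₁) (hc₂ : 0 < c₂) (hb : 0 < b) (hg : 0 < g)
    (hM : 0 < M)
    (p : ℝ → ℝ)
    (hp : ∀ s : ℝ, p s = -(c₁ / b) * s ^ 2 + (c₁ * (M - g) / b - c₂) * s + c₂ * M)
    (y : ℝ → ℝ) (hy : Differentiable ℝ y)
    (hode : ∀ t : ℝ, 0 ≤ t → deriv y t = p (y t))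
    (hy0 : y 0 ∈ Set.Icc (0 : ℝ) M) :
    ∀ t : ℝ, 0 ≤ t → y t ∈ Set.Icc (0 : ℝ) M := by
  intro t ht
  have h0 : p 0 = c₂ * M := by rw [hp]; ring
  have hMv : p M = -(c₁ / b * g * M) := by rw [hp]; ring
  have h0pos : 0 < p 0 := by rw [h0]; positivity
  have hMneg : p M < 0 := by
    rw [hMv]
    have : 0 < c₁ / b * g * M := by positivity
    linarith
  constructor
  · have h := image_le_of_deriv_right_lt_deriv_boundary (f := fun x => -y x)
      (f' := fun x => -deriv y x) (a := 0) (b := t) (B := fun _ => 0) (B' := fun _ => 0)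
      hy.continuous.neg.continuousOn
      (fun x _ => (hy x).hasDerivAt.neg.hasDerivWithinAt)
      (by simpa using hy0.1) (fun x => hasDerivAt_const x 0)
      (fun x hx hxe => by
        have e : y x = 0 := by simpa using hxe
        change -deriv y x < 0
        rw [hode x hx.1, e]
        linarith) (Set.right_mem_Icc.2 ht)
    simpa using h
  · exact image_le_of_deriv_right_lt_deriv_boundary (f := y)
      (f' := deriv y) (a := 0) (b := t) (B := fun _ => M) (B' := fun _ => 0)
      hy.continuous.continuousOn
      (fun x _ => (hy x).hasDerivAt.hasDerivWithinAt)
      hy0.2 (fun x => hasDerivAt_const x M)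
      (fun x hx hxe => by
        have e : y x = M := hxe
        change deriv y x < 0
        rw [hode x hx.1, e]
        exact hMneg) (Set.right_mem_Icc.2 ht)
end
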